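/- Let G = (U ∪ V, E) be a finite bipartite graph with parts U and V, b : U → ℕ degree bounds on the vertices of U only, f a normalized monotone submodular real-valued function on subsets of E, and ε ∈ (0, 1]. Call a subset M ⊆ E a semi-matching if every vertex u ∈ U is incident to at most b(u) edges of M. Let M = {e₁, …, e_k} be a maximal semi-matching (no edge of E \ M is available with respect to M) admitting an ordering of its edges such that, for each i with M_{i-1} = {e₁, …, e_{i-1}}: (a) e_i is available with respect to M_{i-1}, and (b) for every edge e' adjacent to e_i that is available with respect to M_{i-1}, ρ_{e_i}(M_{i-1}) ≥ ε · ρ_{e'}(M_{i-1}). Then for every semi-matching M* of G, f(M) ≥ (ε / (1 + ε)) · f(M*). -/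

import Mathlib

/-- In a finite bipartite graph with parts `U` and `V` and edge set `E ⊆ U × V`,
a semi-matching is a subset `M ⊆ E` such that every vertex `u ∈ U` is incident to
at most `b u` edges of `M` (degree bounds only on the `U` side). -/
def IsSemiMatching {U V : Type*} [DecidableEq U] [DecidableEq V]
    (E : Finset (U × V)) (b : U → ℕ) (M : Finset (U × V)) : Prop :=
  M ⊆ E ∧ ∀ u : U, (M.filter (fun p => p.1 = u)).card ≤ b u

/-- An edge `e ∈ E` is available with respect to `M` if `e ∉ M` and `M ∪ {e}`
is a semi-matching. -/
def AvailableSemi {U V : Type*} [DecidableEq U] [DecidableEq V]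
    (E : Finset (U × V)) (b : U → ℕ) (M : Finset (U × V)) (e : U × V) : Prop :=
  e ∈ E ∧ e ∉ M ∧ IsSemiMatching E b (M ∪ {e})

/-- Two distinct edges of the bipartite graph are adjacent if they share an endpoint. -/
def BipAdjacent {U V : Type*} (e e' : U × V) : Prop :=
  e ≠ e' ∧ (e.1 = e'.1 ∨ e.2 = e'.2)

/-- The set of the first `i` edges of the ordering `e : Fin k → U × V`. -/
def prefixSet {U V : Type*} [DecidableEq U] [DecidableEq V] {k : ℕ}
    (e : Fin k → U × V) (i : ℕ) : Finset (U × V) :=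
  (Finset.univ.filter (fun j : Fin k => (j : ℕ) < i)).image e

/-- If each fibre of `p` is at most as large as the corresponding fibre of `q`, then there is an
injection compatible with `p` and `q`. -/
theorem exists_injective_comp_eq {α β γ : Type*} [Fintype α] [Fintype β] [DecidableEq γ]
    (p : α → γ) (q : β → γ)
    (h : ∀ c, (Finset.univ.filter (fun a => p a = c)).card ≤
      (Finset.univ.filter (fun x => q x = c)).card) :
    ∃ φ : α → β, Function.Injective φ ∧ ∀ a, q (φ a) = p a := by
  have hemb (c : γ) : Nonempty ({a // p a = c} ↪ {x // q x = c}) := by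
    apply Function.Embedding.nonempty_of_card_le
    simpa only [Fintype.card_subtype] using h c
  refine ⟨fun a => ((hemb (p a)).some ⟨a, rfl⟩).1, fun a a' haa' => ?_,
    fun a => ((hemb (p a)).some ⟨a, rfl⟩).2⟩
  have key (c : γ) (hc : p a' = c) (y : β)
      (hy : ((hemb (p a')).some ⟨a', rfl⟩).1 = y) : ((hemb c).some ⟨a', hc⟩).1 = y := by
    subst hc; exact hy
  have hp : p a' = p a := by
    rw [← ((hemb (p a)).some ⟨a, rfl⟩).2, ← ((hemb (p a')).some ⟨a', rfl⟩).2]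
    exact congrArg q haa'.symm
  have h := key (p a) hp _ haa'.symm
  exact congrArg Subtype.val ((hemb (p a)).some.injective (Subtype.ext h)).symm

/-- A submodular function gains at most the sum of the individual marginal gains. -/
theorem union_le_add_sum_marginal {α : Type*} [DecidableEq α] {E : Finset α}
    {f : Finset α → ℝ}
    (hsub : ∀ A B : Finset α, A ⊆ B → B ⊆ E →
      ∀ e ∈ E, e ∉ B → f (B ∪ {e}) - f B ≤ f (A ∪ {e}) - f A)
    {M S : Finset α} (hM : M ⊆ E) (hS : S ⊆ E) (hdisj : Disjoint M S) :
    f (M ∪ S) ≤ f M + ∑ x ∈ S, (f (M ∪ {x}) - f M) := by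
  induction S using Finset.induction_on with
  | empty => simp
  | insert x S hx ih =>
    rw [Finset.insert_subset_iff] at hS
    rw [Finset.disjoint_insert_right] at hdisj
    have h := hsub M (M ∪ S) Finset.subset_union_left (Finset.union_subset hM hS.2) x hS.1
      (by simp [hx, hdisj.1])
    have heq : M ∪ insert x S = M ∪ S ∪ {x} := by
      ext y; simp only [Finset.mem_union, Finset.mem_insert, Finset.mem_singleton]; tauto
    rw [Finset.sum_insert hx, heq]
    linarith [ih hS.2 hdisj.2]

theorem prefixSet_succ {U V : Type*} [DecidableEq U] [DecidableEq V] {k : ℕ}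
    (e : Fin k → U × V) (i : Fin k) :
    prefixSet e ((i : ℕ) + 1) = prefixSet e (i : ℕ) ∪ {e i} := by
  have h : (Finset.univ.filter fun j : Fin k => (j : ℕ) < (i : ℕ) + 1) =
      (Finset.univ.filter fun j : Fin k => (j : ℕ) < (i : ℕ)) ∪ {i} := by
    ext j
    simp only [Finset.mem_filter, Finset.mem_univ, true_and, Finset.mem_union,
      Finset.mem_singleton, Fin.ext_iff]
    omega
  rw [prefixSet, h, Finset.image_union, Finset.image_singleton, prefixSet]

theorem prefixSet_subset_image {U V : Type*} [DecidableEq U] [DecidableEq V] {k : ℕ}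
    (e : Fin k → U × V) (i : ℕ) : prefixSet e i ⊆ Finset.univ.image e :=
  Finset.image_subset_image (Finset.filter_subset _ _)

/-- The marginal gains along an ordering telescope. -/
theorem sum_marginal_prefixSet {U V : Type*} [DecidableEq U] [DecidableEq V] {k : ℕ}
    (e : Fin k → U × V) (f : Finset (U × V) → ℝ) :
    ∑ i : Fin k, (f (prefixSet e (i : ℕ) ∪ {e i}) - f (prefixSet e (i : ℕ))) =
      f (Finset.univ.image e) - f ∅ := by
  simp_rw [← prefixSet_succ]
  rw [Fin.sum_univ_eq_sum_range (fun i => f (prefixSet e (i + 1)) - f (prefixSet e i)) k,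
    Finset.sum_range_sub fun i => f (prefixSet e i)]
  simp [prefixSet]

/-- Adding an edge outside a semi-matching yields a semi-matching exactly when the degree
bound at its `U`-endpoint is not yet attained. -/
theorem availableSemi_iff {U V : Type*} [DecidableEq U] [DecidableEq V]
    {E : Finset (U × V)} {b : U → ℕ} {M : Finset (U × V)} {x : U × V}
    (hM : IsSemiMatching E b M) (hxE : x ∈ E) (hxM : x ∉ M) :
    AvailableSemi E b M x ↔ (M.filter (fun p => p.1 = x.1)).card < b x.1 := by
  have hcard : ((M ∪ {x}).filter (fun p => p.1 = x.1)).card =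
      (M.filter (fun p => p.1 = x.1)).card + 1 := by
    rw [Finset.union_singleton, Finset.filter_insert, if_pos rfl,
      Finset.card_insert_of_notMem (by simp [hxM])]
  refine ⟨fun h => ?_, fun h => ⟨hxE, hxM, ?_, fun u => ?_⟩⟩
  · have := h.2.2.2 x.1
    omega
  · exact Finset.union_subset hM.1 (by simpa using hxE)
  · rcases eq_or_ne x.1 u with rfl | hu
    · omega
    · rw [Finset.union_singleton, Finset.filter_insert, if_neg hu]
      exact hM.2 u

theorem IsSemiMatching.subset {U V : Type*} [DecidableEq U] [DecidableEq V]
    {E : Finset (U × V)} {b : U → ℕ} {M N : Finset (U × V)}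
    (hM : IsSemiMatching E b M) (hNM : N ⊆ M) : IsSemiMatching E b N :=
  ⟨hNM.trans hM.1, fun u =>
    (Finset.card_le_card (Finset.filter_subset_filter _ hNM)).trans (hM.2 u)⟩

/-- Any maximal semi-matching `M = {e₁, …, e_k}` of a finite bipartite
graph that is `ε`-locally dominant with respect to a normalized monotone submodular
function `f` satisfies `f(M) ≥ (ε / (1 + ε)) · f(M*)` for every semi-matching `M*`. -/
theorem epsLocallyDominant_semiMatching_approx {U V : Type*}
    [Fintype U] [Fintype V] [DecidableEq U] [DecidableEq V]
    (E : Finset (U × V)) (b : U → ℕ)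
    (f : Finset (U × V) → ℝ) (ε : ℝ) (hε0 : 0 < ε) (hε1 : ε ≤ 1)
    (hnorm : f ∅ = 0)
    (hmono : ∀ A B : Finset (U × V), A ⊆ B → B ⊆ E → f A ≤ f B)
    (hsub : ∀ A B : Finset (U × V), A ⊆ B → B ⊆ E →
      ∀ e ∈ E, e ∉ B → f (B ∪ {e}) - f B ≤ f (A ∪ {e}) - f A)
    (k : ℕ) (e : Fin k → U × V) (he : Function.Injective e)
    (M : Finset (U × V)) (hM : M = Finset.univ.image e)
    (hMmax : ∀ e' : U × V, ¬ AvailableSemi E b M e')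
    (ha : ∀ i : Fin k, AvailableSemi E b (prefixSet e (i : ℕ)) (e i))
    (hb : ∀ i : Fin k, ∀ e' : U × V, BipAdjacent (e i) e' →
      AvailableSemi E b (prefixSet e (i : ℕ)) e' →
      ε * (f (prefixSet e (i : ℕ) ∪ {e'}) - f (prefixSet e (i : ℕ))) ≤
        f (prefixSet e (i : ℕ) ∪ {e i}) - f (prefixSet e (i : ℕ)))
    (Mstar : Finset (U × V)) (hMstar : IsSemiMatching E b Mstar) :
    (ε / (1 + ε)) * f Mstar ≤ f M := by
  subst hM
  have hsemi : IsSemiMatching E b (Finset.univ.image e) := by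
    rcases k with _ | k
    · simp [IsSemiMatching]
    · have h := (ha (Fin.last k)).2.2
      rw [← prefixSet_succ] at h
      refine h.subset fun x hx => ?_
      obtain ⟨j, -, rfl⟩ := Finset.mem_image.1 hx
      exact Finset.mem_image_of_mem e (by simp [Fin.is_le])
  set M := Finset.univ.image e with hM
  set S := Mstar \ M with hS
  have hSE : S ⊆ E := Finset.sdiff_subset.trans hMstar.1
  have hSM (x) (hx : x ∈ S) : x ∉ M := (Finset.mem_sdiff.1 hx).2
  obtain ⟨φ, hφ, hφu⟩ := exists_injective_comp_eq
    (fun x : S => x.1.1) (fun i : Fin k => (e i).1) (by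
      intro u
      have hL : (Finset.univ.filter fun x : S => x.1.1 = u).card =
          (S.filter fun x => x.1 = u).card := by
        rw [← Finset.card_map (Function.Embedding.subtype _)]
        congr 1
        ext x
        simp only [Finset.mem_map, Finset.mem_filter, Finset.mem_univ, true_and]
        exact ⟨fun ⟨y, hy, hyx⟩ => hyx ▸ ⟨y.2, hy⟩, fun hx => ⟨⟨x, hx.1⟩, hx.2, rfl⟩⟩
      have hR : (Finset.univ.filter fun i : Fin k => (e i).1 = u).card =
          (M.filter fun x => x.1 = u).card := by
        rw [hM, Finset.filter_image, Finset.card_image_of_injective _ he]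
      rw [hL, hR]
      rcases (S.filter fun x => x.1 = u).eq_empty_or_nonempty with h | ⟨x, hx⟩
      · simp [h]
      · obtain ⟨hxS, rfl⟩ := Finset.mem_filter.1 hx
        have h := hMmax x
        rw [availableSemi_iff hsemi (hSE hxS) (hSM x hxS), not_lt] at h
        exact ((hMstar.subset Finset.sdiff_subset).2 x.1).trans h)
  have hgain (x : S) : ε * (f (M ∪ {x.1}) - f M) ≤
      f (prefixSet e (φ x : ℕ) ∪ {e (φ x)}) - f (prefixSet e (φ x : ℕ)) := by
    have hxE := hSE x.2
    have hxM := hSM x.1 x.2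
    have hsubM := prefixSet_subset_image e (φ x : ℕ)
    have hxP : x.1 ∉ prefixSet e (φ x : ℕ) := fun h => hxM (hsubM h)
    have hpre := hsemi.subset hsubM
    have hav : AvailableSemi E b (prefixSet e (φ x : ℕ)) x.1 := by
      rw [availableSemi_iff hpre hxE hxP, ← hφu x]
      exact (availableSemi_iff hpre (ha (φ x)).1 (ha (φ x)).2.1).1 (ha (φ x))
    have hne : e (φ x) ≠ x.1 := fun h =>
      hxM (h ▸ Finset.mem_image_of_mem e (Finset.mem_univ _))
    exact (mul_le_mul_of_nonneg_left (hsub _ _ hsubM hsemi.1 _ hxE hxM) hε0.le).trans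
      (hb (φ x) x.1 ⟨hne, Or.inl (hφu x)⟩ hav)
  have hsum : ε * ∑ x ∈ S, (f (M ∪ {x}) - f M) ≤ f M := by
    calc ε * ∑ x ∈ S, (f (M ∪ {x}) - f M)
        = ∑ x : S, ε * (f (M ∪ {x.1}) - f M) := by
          rw [Finset.mul_sum, ← Finset.sum_coe_sort]
      _ ≤ ∑ x : S, (f (prefixSet e (φ x : ℕ) ∪ {e (φ x)}) - f (prefixSet e (φ x : ℕ))) :=
          Finset.sum_le_sum fun x _ => hgain x
      _ = ∑ i ∈ Finset.univ.image φ,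
            (f (prefixSet e (i : ℕ) ∪ {e i}) - f (prefixSet e (i : ℕ))) := by
          rw [Finset.sum_image hφ.injOn]
      _ ≤ ∑ i : Fin k, (f (prefixSet e (i : ℕ) ∪ {e i}) - f (prefixSet e (i : ℕ))) :=
          Finset.sum_le_sum_of_subset_of_nonneg (Finset.subset_univ _) fun i _ _ =>
            sub_nonneg.2 (hmono _ _ Finset.subset_union_left (ha i).2.2.1)
      _ = f M := by rw [sum_marginal_prefixSet, hnorm, sub_zero]
  have hunion := union_le_add_sum_marginal hsub hsemi.1 hSE Finset.disjoint_sdiff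
  have hstar : f Mstar ≤ f (M ∪ S) :=
    hmono _ _ (by rw [hS, Finset.union_sdiff_self_eq_union]; exact Finset.subset_union_right)
      (Finset.union_subset hsemi.1 hSE)
  rw [div_mul_eq_mul_div, div_le_iff₀ (by linarith)]
  linarith [mul_le_mul_of_nonneg_left (hstar.trans hunion) hε0.le]
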